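/- arXiv:2302.05273 — 2 statements merged into one kernel-verified Lean document; each statement's English description precedes it below -/
import Mathlib

section
/- There exists an absolute constant C ≥ 1 such that, whenever the right-hand side is finite, the following bounds hold. For every bounded continuous v : ℝ → ℂ and j ∈ {0,1}: ‖∂ₓʲ I₁[v]‖_{L^∞} ≤ C‖v‖_{L^∞}, ‖∂ₓʲ J[v]‖_{L^∞} ≤ C‖v‖_{L^∞}, and ‖∂ₓʲ(P_c J[v])‖_{L^∞} ≤ C‖v‖_{L^∞}, where P_c h := h − (∫_ℝ Y₀ h) Y₀ − (∫_ℝ Y₁ h) Y₁. For every measurable v with ⟨x⟩v ∈ L²(ℝ): ‖⟨x⟩ I₁[v]‖_{L²} ≤ C‖⟨x⟩v‖_{L²} and ‖⟨x⟩ J[v]‖_{L²} ≤ C‖⟨x⟩v‖_{L²}. For every continuously differentiable v and j ∈ {0,1}: ‖⟨x⟩⁻¹ ∂ₓʲ Ĩ₁[∂ₓv]‖_{L²} ≤ C‖⟨x⟩⁻¹ ∂ₓv‖_{L²}, ‖⟨x⟩⁻¹ ∂ₓʲ J̃[∂ₓv]‖_{L²} ≤ C‖⟨x⟩⁻¹ ∂ₓv‖_{L²},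 ‖⟨x⟩⁻¹ Ĩ₁[∂ₓv]‖_{L^∞} ≤ C‖⟨x⟩⁻¹ ∂ₓv‖_{L²}, and ‖⟨x⟩⁻¹ J̃[∂ₓv]‖_{L^∞} ≤ C‖⟨x⟩⁻¹ ∂ₓv‖_{L²}. -/
open MeasureTheory
open scoped ENNReal

noncomputable section

/-- `sech x = 1 / cosh x`. -/
def sech (x : ℝ) : ℝ := 1 / Real.cosh x

/-- `Y₀(x) = √(3/4) sech² x`. -/
def Y0 (x : ℝ) : ℝ := Real.sqrt (3 / 4) * sech x ^ 2

/-- `Y₁(x) = √(3/2) sech x tanh x`. -/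
def Y1 (x : ℝ) : ℝ := Real.sqrt (3 / 2) * sech x * Real.tanh x

/-- The Japanese bracket `⟨x⟩ = (1 + x²)^{1/2}`. -/
def jb (x : ℝ) : ℝ := Real.sqrt (1 + x ^ 2)

/-- `I₁[g](x) = sech x ∫₀ˣ cosh y · g(y) dy`. -/
def I1op (g : ℝ → ℂ) (x : ℝ) : ℂ := (sech x : ℂ) * ∫ y in (0 : ℝ)..x, (Real.cosh y : ℂ) * g y

/-- `I₂[g](x) = sech² x ∫₀ˣ cosh² y · g(y) dy`. -/
def I2op (g : ℝ → ℂ) (x : ℝ) : ℂ :=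
  (sech x : ℂ) ^ 2 * ∫ y in (0 : ℝ)..x, (Real.cosh y : ℂ) ^ 2 * g y

/-- `J[g] = I₂[I₁[g]]`. -/
def Jop (g : ℝ → ℂ) : ℝ → ℂ := I2op (I1op g)

/-- `Ĩ₁[h](x) = −sech x ∫₀ˣ sinh y · h(y) dy`. -/
def I1til (h : ℝ → ℂ) (x : ℝ) : ℂ := -(sech x : ℂ) * ∫ y in (0 : ℝ)..x, (Real.sinh y : ℂ) * h y

/-- `J̃[h](x) = −(1/2) sech² x ∫₀ˣ sinh² y · h(y) dy`. -/
def Jtil (h : ℝ → ℂ) (x : ℝ) : ℂ :=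
  -(1 / 2 : ℂ) * (sech x : ℂ) ^ 2 * ∫ y in (0 : ℝ)..x, (Real.sinh y : ℂ) ^ 2 * h y

/-- Projection onto the continuous spectral subspace:
`P_c h = h − (∫ Y₀ h) Y₀ − (∫ Y₁ h) Y₁`. -/
def Pc (h : ℝ → ℂ) (x : ℝ) : ℂ :=
  h x - (∫ y : ℝ, (Y0 y : ℂ) * h y) * (Y0 x : ℂ) - (∫ y : ℝ, (Y1 y : ℂ) * h y) * (Y1 x : ℂ)

/-- Majorant convolution operator. -/
def Aop (f : ℝ → ℝ≥0∞) (x : ℝ) : ℝ≥0∞ :=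
  ∫⁻ y, ENNReal.ofReal (4 * Real.exp (-(1 / 2) * |x - y|)) * f y

lemma integrable_exp_abs (a : ℝ) (ha : a < 0) :
    Integrable (fun z : ℝ => Real.exp (a * |z|)) := by
  apply Integrable.of_integral_ne_zero
  rw [integral_comp_abs (f := fun z => Real.exp (a * z)), integral_exp_mul_Ioi ha 0]
  simp [ha.ne]

lemma lint_exp_abs (a c : ℝ) (ha : a < 0) (hc : 0 ≤ c) (x : ℝ) :
    ∫⁻ y, ENNReal.ofReal (c * Real.exp (a * |x - y|)) = ENNReal.ofReal (c * (2 / (-a))) := by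
  rw [lintegral_sub_left_eq_self (fun z : ℝ => ENNReal.ofReal (c * Real.exp (a * |z|))) x]
  rw [← ofReal_integral_eq_lintegral_ofReal]
  · rw [integral_const_mul, integral_comp_abs (f := fun z => Real.exp (a * z)),
      integral_exp_mul_Ioi ha 0]
    congr 2
    simp
    ring
  · exact (integrable_exp_abs a ha).const_mul c
  · exact Filter.Eventually.of_forall fun z => by positivity

lemma lint_exp_abs' (a c : ℝ) (ha : a < 0) (hc : 0 ≤ c) (y : ℝ) :
    ∫⁻ x, ENNReal.ofReal (c * Real.exp (a * |x - y|)) = ENNReal.ofReal (c * (2 / (-a))) := by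
  rw [← lint_exp_abs a c ha hc y]
  simp_rw [abs_sub_comm]

lemma kmeas : Measurable (fun p : ℝ × ℝ =>
    ENNReal.ofReal (4 * Real.exp (-(1 / 2) * |p.1 - p.2|))) := by
  have : Continuous (fun p : ℝ × ℝ => 4 * Real.exp (-(1 / 2) * |p.1 - p.2|)) := by fun_prop
  exact this.measurable.ennreal_ofReal

lemma kmeas1 (x : ℝ) : Measurable (fun y : ℝ =>
    ENNReal.ofReal (4 * Real.exp (-(1 / 2) * |x - y|))) :=
  kmeas.comp measurable_prodMk_left

lemma kmeas2 (y : ℝ) : Measurable (fun x : ℝ =>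
    ENNReal.ofReal (4 * Real.exp (-(1 / 2) * |x - y|))) :=
  kmeas.comp measurable_prodMk_right

lemma Aop_measurable {f : ℝ → ℝ≥0∞} (hf : Measurable f) : Measurable (Aop f) := by
  unfold Aop
  exact Measurable.lintegral_prod_right' (kmeas.mul (hf.comp measurable_snd))

lemma Aop_mono {f g : ℝ → ℝ≥0∞} (h : ∀ x, f x ≤ g x) (x : ℝ) : Aop f x ≤ Aop g x := by
  unfold Aop
  gcongr with y
  exact h y

lemma Aop_const (c : ℝ≥0∞) (x : ℝ) : Aop (fun _ => c) x = 16 * c := by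
  unfold Aop
  rw [lintegral_mul_const _ (kmeas1 x),
    lint_exp_abs _ _ (by norm_num) (by norm_num)]
  norm_num

lemma eL2_eq (F : ℝ → ℝ≥0∞) :
    eLpNorm F 2 volume = (∫⁻ x, F x ^ (2 : ℝ)) ^ (1 / 2 : ℝ) := by
  rw [eLpNorm_eq_lintegral_rpow_enorm_toReal (by norm_num) (by norm_num)]
  simp

lemma Aop_sq_le {f : ℝ → ℝ≥0∞} (hf : Measurable f) (x : ℝ) :
    Aop f x ^ (2 : ℝ) ≤
      16 * ∫⁻ y, ENNReal.ofReal (4 * Real.exp (-(1 / 2) * |x - y|)) * f y ^ (2 : ℝ) := by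
  set s : ℝ → ℝ≥0∞ := fun y => ENNReal.ofReal (2 * Real.exp (-(1 / 4) * |x - y|)) with hs
  have hsm : Measurable s := by
    have : Continuous (fun y : ℝ => 2 * Real.exp (-(1 / 4) * |x - y|)) := by fun_prop
    exact this.measurable.ennreal_ofReal
  have hss : ∀ y, s y * s y = ENNReal.ofReal (4 * Real.exp (-(1 / 2) * |x - y|)) := by
    intro y
    rw [hs]
    simp only
    rw [← ENNReal.ofReal_mul (by positivity)]
    congr 1
    have : Real.exp (-(1 / 2) * |x - y|) =
        Real.exp (-(1 / 4) * |x - y|) * Real.exp (-(1 / 4) * |x - y|) := by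
      rw [← Real.exp_add]; congr 1; ring
    rw [this]; ring
  have hp : (2 : ℝ).HolderConjugate 2 := by
    rw [Real.holderConjugate_iff]; norm_num
  have h := ENNReal.lintegral_mul_le_Lp_mul_Lq volume hp hsm.aemeasurable
    (hsm.mul hf).aemeasurable
  have e1 : ∫⁻ y, (s * (s * f)) y = Aop f x := by
    unfold Aop
    refine lintegral_congr fun y => ?_
    simp only [Pi.mul_apply]
    rw [← mul_assoc, hss]
  have e2 : ∫⁻ y, s y ^ (2 : ℝ) = 16 := by
    rw [show (16 : ℝ≥0∞) = ENNReal.ofReal (4 * (2 / (-(-(1 / 2))))) by norm_num,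
      ← lint_exp_abs (-(1 / 2)) 4 (by norm_num) (by norm_num) x]
    refine lintegral_congr fun y => ?_
    rw [← hss, ENNReal.rpow_two, sq]
  have e3 : ∫⁻ y, ((s * f) y) ^ (2 : ℝ) =
      ∫⁻ y, ENNReal.ofReal (4 * Real.exp (-(1 / 2) * |x - y|)) * f y ^ (2 : ℝ) := by
    refine lintegral_congr fun y => ?_
    rw [← hss, ENNReal.rpow_two, ENNReal.rpow_two, Pi.mul_apply]
    ring
  rw [e1, e2] at h
  have h' := ENNReal.rpow_le_rpow h (by norm_num : (0 : ℝ) ≤ 2)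
  rw [ENNReal.mul_rpow_of_nonneg _ _ (by norm_num : (0 : ℝ) ≤ 2), ← ENNReal.rpow_mul,
    ← ENNReal.rpow_mul] at h'
  norm_num at h'
  simp only [Pi.mul_apply] at e3
  norm_num at e3
  rw [e3] at h'
  norm_num
  exact h'

lemma Aop_L2 {f : ℝ → ℝ≥0∞} (hf : Measurable f) :
    eLpNorm (Aop f) 2 volume ≤ 16 * eLpNorm f 2 volume := by
  have hkm : Measurable (fun p : ℝ × ℝ =>
      ENNReal.ofReal (4 * Real.exp (-(1 / 2) * |p.1 - p.2|)) * f p.2 ^ (2 : ℝ)) :=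
    kmeas.mul ((hf.comp measurable_snd).pow_const _)
  have h : ∫⁻ x, Aop f x ^ (2 : ℝ) ≤ 16 ^ (2 : ℝ) * ∫⁻ x, f x ^ (2 : ℝ) := by
    calc ∫⁻ x, Aop f x ^ (2 : ℝ)
        ≤ ∫⁻ x, 16 * ∫⁻ y,
          ENNReal.ofReal (4 * Real.exp (-(1 / 2) * |x - y|)) * f y ^ (2 : ℝ) :=
          lintegral_mono fun x => Aop_sq_le hf x
      _ = 16 * ∫⁻ x, ∫⁻ y,
          ENNReal.ofReal (4 * Real.exp (-(1 / 2) * |x - y|)) * f y ^ (2 : ℝ) := by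
          rw [lintegral_const_mul _ (Measurable.lintegral_prod_right' hkm)]
      _ = 16 * ∫⁻ y, ∫⁻ x,
          ENNReal.ofReal (4 * Real.exp (-(1 / 2) * |x - y|)) * f y ^ (2 : ℝ) := by
          rw [lintegral_lintegral_swap hkm.aemeasurable]
      _ = 16 * ∫⁻ y, 16 * f y ^ (2 : ℝ) := by
          congr 1
          refine lintegral_congr fun y => ?_
          rw [lintegral_mul_const _ (kmeas2 y),
            lint_exp_abs' _ _ (by norm_num) (by norm_num)]
          norm_num
      _ = 16 ^ (2 : ℝ) * ∫⁻ x, f x ^ (2 : ℝ) := by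
          rw [lintegral_const_mul _ (hf.pow_const _), ENNReal.rpow_two]
          ring
  rw [eL2_eq, eL2_eq]
  refine (ENNReal.rpow_le_rpow h (by norm_num : (0 : ℝ) ≤ 1 / 2)).trans ?_
  rw [ENNReal.mul_rpow_of_nonneg _ _ (by norm_num), ← ENNReal.rpow_mul]
  norm_num

lemma Aop_Linf {f : ℝ → ℝ≥0∞} (hf : Measurable f) (x : ℝ) :
    Aop f x ≤ 32 * eLpNorm f 2 volume := by
  have hp : (2 : ℝ).HolderConjugate 2 := by
    rw [Real.holderConjugate_iff]; norm_num
  have h := ENNReal.lintegral_mul_le_Lp_mul_Lq volume hp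
    (kmeas.comp (measurable_prodMk_left (x := x))).aemeasurable hf.aemeasurable
  have e2 : ∫⁻ y, ENNReal.ofReal (4 * Real.exp (-(1 / 2) * |x - y|)) ^ (2 : ℝ) = 32 := by
    rw [show (32 : ℝ≥0∞) = ENNReal.ofReal (16 * (2 / (-(-1)))) by norm_num,
      ← lint_exp_abs (-1) 16 (by norm_num) (by norm_num) x]
    refine lintegral_congr fun y => ?_
    rw [ENNReal.rpow_two, sq, ← ENNReal.ofReal_mul (by positivity)]
    congr 1
    have : Real.exp (-1 * |x - y|) =
        Real.exp (-(1 / 2) * |x - y|) * Real.exp (-(1 / 2) * |x - y|) := by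
      rw [← Real.exp_add]; congr 1; ring
    rw [this]; ring
  rw [eL2_eq]
  refine h.trans ?_
  gcongr
  simp only [Function.comp_apply]
  rw [e2]
  calc (32 : ℝ≥0∞) ^ (1 / 2 : ℝ) ≤ 32 ^ (1 : ℝ) :=
        ENNReal.rpow_le_rpow_of_exponent_le (by norm_num) (by norm_num)
    _ = 32 := by simp

/-- Admissible weights. -/
def GoodW (w : ℝ → ℂ) : Prop := ∀ x y, ‖w x‖ ≤ 2 * Real.exp (1 / 2 * |x - y|) * ‖w y‖

lemma core {w : ℝ → ℂ} (hw : GoodW w) (c g : ℝ → ℂ) (x : ℝ)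
    (hc : ∀ y, |y| ≤ |x| → ‖c y‖ ≤ Real.cosh y / Real.cosh x) :
    ‖w x * ∫ y in (0 : ℝ)..x, c y * g y‖ₑ ≤ Aop (fun y => ‖w y * g y‖ₑ) x := by
  rw [← intervalIntegral.integral_const_mul, intervalIntegral.intervalIntegral_eq_integral_uIoc]
  have h1 : ‖(if (0 : ℝ) ≤ x then (1 : ℝ) else -1) •
      ∫ y in Set.uIoc 0 x, w x * (c y * g y)‖ₑ ≤ ∫⁻ y in Set.uIoc 0 x, ‖w x * (c y * g y)‖ₑ := by
    refine le_trans (le_of_eq ?_) (enorm_integral_le_lintegral_enorm _)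
    split_ifs <;> simp
  refine h1.trans ?_
  unfold Aop
  refine le_trans (setLIntegral_mono' measurableSet_uIoc (fun y hy => ?_))
    (setLIntegral_le_lintegral _ _)
  have hy' : |x| - |y| = |x - y| ∧ |y| ≤ |x| := by
    rcases le_total 0 x with hx | hx
    · rw [Set.uIoc_of_le hx] at hy
      rw [abs_of_nonneg hx, abs_of_pos hy.1, abs_of_nonneg (by linarith [hy.2])]
      exact ⟨rfl, hy.2⟩
    · rw [Set.uIoc_of_ge hx] at hy
      rw [abs_of_nonpos hx, abs_of_nonpos hy.2, abs_of_nonpos (by linarith [hy.1])]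
      constructor <;> linarith [hy.1]
  have hcy := hc y hy'.2
  have hcosh : Real.cosh y / Real.cosh x ≤ 2 * Real.exp (-|x - y|) := by
    rw [div_le_iff₀ (Real.cosh_pos x), ← hy'.1, ← Real.cosh_abs y, ← Real.cosh_abs x,
      Real.cosh_eq, Real.cosh_eq]
    have e1 : Real.exp (-(|x| - |y|)) * Real.exp |x| = Real.exp |y| := by
      rw [← Real.exp_add]; congr 1; ring
    have e2 : Real.exp (-|y|) ≤ Real.exp |y| :=
      Real.exp_le_exp.2 (by linarith [abs_nonneg y])
    have e3 : 0 < Real.exp (-(|x| - |y|)) * Real.exp (-|x|) := by positivity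
    nlinarith
  change _ ≤ _ * ‖w y * g y‖ₑ
  rw [← ofReal_norm, ← ofReal_norm, ← ENNReal.ofReal_mul (by positivity)]
  apply ENNReal.ofReal_le_ofReal
  rw [norm_mul, norm_mul, norm_mul]
  have e4 : Real.exp (-(1 / 2) * |x - y|) = Real.exp (1 / 2 * |x - y|) * Real.exp (-|x - y|) := by
    rw [← Real.exp_add]; congr 1; ring
  calc ‖w x‖ * (‖c y‖ * ‖g y‖)
      ≤ (2 * Real.exp (1 / 2 * |x - y|) * ‖w y‖) * ((2 * Real.exp (-|x - y|)) * ‖g y‖) := by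
        gcongr
        · exact hw x y
        · exact hcy.trans hcosh
    _ = _ := by rw [e4]; ring

lemma jb_pos (x : ℝ) : 0 < jb x := by unfold jb; positivity

lemma jb_le (x y : ℝ) : jb x ≤ 2 * Real.exp (1 / 2 * |x - y|) * jb y := by
  have h1 : 1 + |x - y| ≤ 2 * Real.exp (1 / 2 * |x - y|) := by
    have := Real.add_one_le_exp (1 / 2 * |x - y|)
    linarith
  refine le_trans ?_ (mul_le_mul_of_nonneg_right h1 (jb_pos y).le)
  have hy : |y| ≤ jb y := by
    unfold jb; apply Real.le_sqrt_of_sq_le; rw [sq_abs]; linarith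
  have hy1 : 1 ≤ jb y := by
    unfold jb; apply Real.le_sqrt_of_sq_le; nlinarith [sq_nonneg y]
  have hs : jb y ^ 2 = 1 + y ^ 2 := by unfold jb; exact Real.sq_sqrt (by positivity)
  have ht := abs_nonneg (x - y)
  unfold jb
  rw [Real.sqrt_le_left (by have := jb_pos y; unfold jb at this; positivity)]
  change 1 + x ^ 2 ≤ ((1 + |x - y|) * jb y) ^ 2
  rw [mul_pow, hs]
  have hx : x ^ 2 ≤ (|x - y| + |y|) ^ 2 := by
    rw [← sq_abs x]
    have : |x| ≤ |x - y| + |y| := by simpa using abs_add_le (x - y) y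
    gcongr
  have h2 : 2 * |y| ≤ 2 * (1 + y ^ 2) := by nlinarith [sq_abs y, sq_nonneg (|y| - 1)]
  nlinarith [sq_abs y, mul_le_mul_of_nonneg_left h2 ht, sq_nonneg (|x - y| * y),
    sq_nonneg (|x-y|), mul_nonneg (sq_nonneg (|x - y|)) (sq_nonneg y)]

lemma goodW_jb : GoodW (fun x => (jb x : ℂ)) := by
  intro x y
  simp only [Complex.norm_real, Real.norm_eq_abs, abs_of_pos (jb_pos _)]
  exact jb_le x y

lemma goodW_jbinv : GoodW (fun x => (jb x : ℂ)⁻¹) := by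
  intro x y
  simp only [norm_inv, Complex.norm_real, Real.norm_eq_abs, abs_of_pos (jb_pos _)]
  have h := jb_le y x
  rw [abs_sub_comm] at h
  rw [← div_eq_mul_inv, le_div_iff₀ (jb_pos y), inv_mul_le_iff₀ (jb_pos x)]
  linarith

lemma goodW_one : GoodW (fun _ => (1 : ℂ)) := by
  intro x y
  have := Real.one_le_exp (show 0 ≤ 1 / 2 * |x - y| by positivity)
  simp only [norm_one]; linarith

lemma cosh_ratio {x y : ℝ} (h : |y| ≤ |x|) :
    (Real.cosh y / Real.cosh x) ^ 2 ≤ Real.cosh y / Real.cosh x := by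
  have h1 : Real.cosh y / Real.cosh x ≤ 1 :=
    (div_le_one (Real.cosh_pos x)).2 (Real.cosh_le_cosh.2 h)
  have h0 : 0 ≤ Real.cosh y / Real.cosh x := by have := Real.cosh_pos x; have := Real.cosh_pos y; positivity
  nlinarith

lemma abs_sinh_le (y : ℝ) : |Real.sinh y| ≤ Real.cosh y := by
  rw [Real.abs_sinh, ← Real.cosh_abs]; exact (Real.sinh_lt_cosh _).le

lemma I1op_bd {w : ℝ → ℂ} (hw : GoodW w) (g : ℝ → ℂ) (x : ℝ) :
    ‖w x * I1op g x‖ₑ ≤ Aop (fun y => ‖w y * g y‖ₑ) x := by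
  have h := core hw (fun y => (sech x : ℂ) * (Real.cosh y : ℂ)) g x (fun y _ => by
    rw [norm_mul, Complex.norm_real, Complex.norm_real, Real.norm_eq_abs, Real.norm_eq_abs,
      abs_of_pos (Real.cosh_pos y), sech, abs_of_pos (by have := Real.cosh_pos x; positivity)]
    apply le_of_eq; ring)
  simp_rw [mul_assoc] at h
  rw [intervalIntegral.integral_const_mul] at h
  exact h

lemma I2op_bd {w : ℝ → ℂ} (hw : GoodW w) (g : ℝ → ℂ) (x : ℝ) :
    ‖w x * I2op g x‖ₑ ≤ Aop (fun y => ‖w y * g y‖ₑ) x := by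
  have h := core hw (fun y => (sech x : ℂ) ^ 2 * (Real.cosh y : ℂ) ^ 2) g x (fun y hy => by
    refine le_trans (le_of_eq ?_) (cosh_ratio hy)
    rw [norm_mul, norm_pow, norm_pow, Complex.norm_real, Complex.norm_real, Real.norm_eq_abs,
      Real.norm_eq_abs, abs_of_pos (Real.cosh_pos y), sech, abs_of_pos (by have := Real.cosh_pos x; positivity)]
    ring)
  simp_rw [mul_assoc] at h
  rw [intervalIntegral.integral_const_mul] at h
  exact h

lemma Jop_bd {w : ℝ → ℂ} (hw : GoodW w) (g : ℝ → ℂ) (x : ℝ) :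
    ‖w x * Jop g x‖ₑ ≤ Aop (Aop (fun y => ‖w y * g y‖ₑ)) x :=
  (I2op_bd hw (I1op g) x).trans (Aop_mono (fun y => I1op_bd hw g y) x)

lemma I1til_bd {w : ℝ → ℂ} (hw : GoodW w) (g : ℝ → ℂ) (x : ℝ) :
    ‖w x * I1til g x‖ₑ ≤ Aop (fun y => ‖w y * g y‖ₑ) x := by
  have h := core hw (fun y => -(sech x : ℂ) * (Real.sinh y : ℂ)) g x (fun y _ => by
    rw [norm_mul, norm_neg, Complex.norm_real, Complex.norm_real, Real.norm_eq_abs,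
      Real.norm_eq_abs, sech, abs_of_pos (by have := Real.cosh_pos x; positivity), mul_comm,
      ← div_eq_mul_one_div]
    have := Real.cosh_pos x
    gcongr
    exact abs_sinh_le y)
  simp_rw [mul_assoc] at h
  rw [intervalIntegral.integral_const_mul] at h
  exact h

lemma Jtil_bd {w : ℝ → ℂ} (hw : GoodW w) (g : ℝ → ℂ) (x : ℝ) :
    ‖w x * Jtil g x‖ₑ ≤ Aop (fun y => ‖w y * g y‖ₑ) x := by
  have h := core hw (fun y => (-(1 / 2 : ℂ) * (sech x : ℂ) ^ 2) * (Real.sinh y : ℂ) ^ 2) g x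
    (fun y hy => by
    refine le_trans ?_ (cosh_ratio hy)
    rw [norm_mul, norm_mul, norm_neg, norm_pow, norm_pow, Complex.norm_real, Complex.norm_real,
      Real.norm_eq_abs, Real.norm_eq_abs, sech,
      abs_of_pos (by have := Real.cosh_pos x; positivity)]
    have h1 := abs_sinh_le y
    have h2 : |Real.sinh y| ^ 2 ≤ Real.cosh y ^ 2 := by gcongr
    have h3 : ‖(1 / 2 : ℂ)‖ ≤ 1 := by norm_num
    calc ‖(1 / 2 : ℂ)‖ * (1 / Real.cosh x) ^ 2 * |Real.sinh y| ^ 2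
        ≤ 1 * (1 / Real.cosh x) ^ 2 * Real.cosh y ^ 2 := by gcongr
      _ = _ := by ring)
  simp_rw [mul_assoc] at h
  rw [intervalIntegral.integral_const_mul, intervalIntegral.integral_const_mul] at h
  unfold Jtil
  simp_rw [mul_assoc]
  exact h

lemma sech_hasDeriv (x : ℝ) :
    HasDerivAt (fun x => (sech x : ℂ)) (-((sech x : ℂ) * (Real.tanh x : ℂ))) x := by
  have h : HasDerivAt sech (-(sech x * Real.tanh x)) x := by
    have h0 := (Real.hasDerivAt_cosh x).inv (Real.cosh_pos x).ne'
    have e : sech = (Real.cosh)⁻¹ := by funext y; simp [sech]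
    rw [e]
    refine h0.congr_deriv ?_
    rw [Real.tanh_eq_sinh_div_cosh]
    simp only [Pi.inv_apply]
    have := (Real.cosh_pos x).ne'
    field_simp
  have := h.ofReal_comp
  push_cast at this ⊢
  exact this

lemma sech_cosh (x : ℝ) : (sech x : ℂ) * (Real.cosh x : ℂ) = 1 := by
  have := (Real.cosh_pos x).ne'
  rw [← Complex.ofReal_mul, sech]
  field_simp
  simp

lemma sech_sinh (x : ℝ) : (sech x : ℂ) * (Real.sinh x : ℂ) = (Real.tanh x : ℂ) := by
  rw [← Complex.ofReal_mul, sech, Real.tanh_eq_sinh_div_cosh]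
  congr 1; ring

lemma prim_hasDeriv {F : ℝ → ℂ} (hF : Continuous F) (x : ℝ) :
    HasDerivAt (fun x => ∫ y in (0 : ℝ)..x, F y) (F x) x :=
  intervalIntegral.integral_hasDerivAt_right (hF.intervalIntegrable _ _)
    (hF.stronglyMeasurableAtFilter _ _) hF.continuousAt

lemma I1op_hasDeriv {g : ℝ → ℂ} (hg : Continuous g) (x : ℝ) :
    HasDerivAt (I1op g) (g x - Real.tanh x * I1op g x) x := by
  have hF : Continuous (fun y : ℝ => (Real.cosh y : ℂ) * g y) :=
    (Complex.continuous_ofReal.comp Real.continuous_cosh).mul hg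
  refine ((sech_hasDeriv x).mul (prim_hasDeriv hF x)).congr_deriv ?_
  unfold I1op
  linear_combination g x * sech_cosh x

lemma I2op_hasDeriv {g : ℝ → ℂ} (hg : Continuous g) (x : ℝ) :
    HasDerivAt (I2op g) (g x - 2 * Real.tanh x * I2op g x) x := by
  have hF : Continuous (fun y : ℝ => (Real.cosh y : ℂ) ^ 2 * g y) :=
    ((Complex.continuous_ofReal.comp Real.continuous_cosh).pow 2).mul hg
  refine (((sech_hasDeriv x).pow 2).mul (prim_hasDeriv hF x)).congr_deriv ?_
  unfold I2op
  simp only [Pi.pow_apply, Nat.cast_ofNat]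
  linear_combination g x * (sech x * Real.cosh x + 1) * sech_cosh x

lemma I1til_hasDeriv {g : ℝ → ℂ} (hg : Continuous g) (x : ℝ) :
    HasDerivAt (I1til g) (-(Real.tanh x * g x) - Real.tanh x * I1til g x) x := by
  have hF : Continuous (fun y : ℝ => (Real.sinh y : ℂ) * g y) :=
    (Complex.continuous_ofReal.comp Real.continuous_sinh).mul hg
  refine ((sech_hasDeriv x).neg.mul (prim_hasDeriv hF x)).congr_deriv ?_
  unfold I1til
  simp only [Pi.neg_apply]
  linear_combination - g x * sech_sinh x

lemma Jtil_hasDeriv {g : ℝ → ℂ} (hg : Continuous g) (x : ℝ) :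
    HasDerivAt (Jtil g) (-(1 / 2 * Real.tanh x ^ 2 * g x) - 2 * Real.tanh x * Jtil g x) x := by
  have hF : Continuous (fun y : ℝ => (Real.sinh y : ℂ) ^ 2 * g y) :=
    ((Complex.continuous_ofReal.comp Real.continuous_sinh).pow 2).mul hg
  refine ((((sech_hasDeriv x).pow 2).const_mul (-(1 / 2 : ℂ))).mul
    (prim_hasDeriv hF x)).congr_deriv ?_
  unfold Jtil
  simp only [Pi.pow_apply, Nat.cast_ofNat]
  rw [← sech_sinh]
  ring

lemma I1op_cont {g : ℝ → ℂ} (hg : Continuous g) : Continuous (I1op g) :=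
  continuous_iff_continuousAt.2 fun x => (I1op_hasDeriv hg x).continuousAt

lemma Jop_hasDeriv {g : ℝ → ℂ} (hg : Continuous g) (x : ℝ) :
    HasDerivAt (Jop g) (I1op g x - 2 * Real.tanh x * Jop g x) x :=
  I2op_hasDeriv (I1op_cont hg) x

lemma tanh_norm (x : ℝ) : ‖(Real.tanh x : ℂ)‖ ≤ 1 := by
  rw [Complex.norm_real]; exact (Real.abs_tanh_lt_one x).le

lemma sup_I1 {g : ℝ → ℂ} {M : ℝ} (hM : ∀ x, ‖g x‖ ≤ M) (x : ℝ) : ‖I1op g x‖ ≤ 16 * M := by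
  have hM0 : 0 ≤ M := (norm_nonneg _).trans (hM 0)
  have h := I1op_bd goodW_one g x
  simp only [one_mul] at h
  have h2 := h.trans (Aop_mono (g := fun _ => ENNReal.ofReal M) (fun y => by
    rw [← ofReal_norm]; exact ENNReal.ofReal_le_ofReal (hM y)) x)
  rw [Aop_const, ← ofReal_norm, show (16 : ℝ≥0∞) = ENNReal.ofReal 16 by norm_num,
    ← ENNReal.ofReal_mul (by norm_num), ENNReal.ofReal_le_ofReal_iff (by positivity)] at h2
  exact h2

lemma sup_J {g : ℝ → ℂ} {M : ℝ} (hM : ∀ x, ‖g x‖ ≤ M) (x : ℝ) : ‖Jop g x‖ ≤ 256 * M := by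
  have hM0 : 0 ≤ M := (norm_nonneg _).trans (hM 0)
  have h := I2op_bd goodW_one (I1op g) x
  simp only [one_mul] at h
  have h2 := h.trans (Aop_mono (g := fun _ => ENNReal.ofReal (16 * M)) (fun y => by
    rw [← ofReal_norm]; exact ENNReal.ofReal_le_ofReal (sup_I1 hM y)) x)
  rw [Aop_const, ← ofReal_norm, show (16 : ℝ≥0∞) = ENNReal.ofReal 16 by norm_num,
    ← ENNReal.ofReal_mul (by norm_num), ENNReal.ofReal_le_ofReal_iff (by positivity)] at h2
  unfold Jop
  linarith

lemma sech_pos (x : ℝ) : 0 < sech x := by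
  have := Real.cosh_pos x
  unfold sech; positivity

lemma sech_le_one (x : ℝ) : sech x ≤ 1 := by
  unfold sech
  exact (div_le_one (Real.cosh_pos x)).2 (Real.one_le_cosh x)

lemma sech_le_exp (x : ℝ) : sech x ≤ 2 * Real.exp (-1 * |x|) := by
  unfold sech
  rw [div_le_iff₀ (Real.cosh_pos x), ← Real.cosh_abs x, Real.cosh_eq]
  have e1 : Real.exp (-1 * |x|) * Real.exp |x| = 1 := by
    rw [← Real.exp_add]; simp
  have e3 : 0 < Real.exp (-1 * |x|) * Real.exp (-|x|) := by positivity
  nlinarith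

lemma sech_norm (x : ℝ) : ‖(sech x : ℂ)‖ ≤ 1 := by
  rw [Complex.norm_real, Real.norm_eq_abs, abs_of_pos (sech_pos x)]; exact sech_le_one x

lemma s34 : ‖((Real.sqrt (3 / 4) : ℝ) : ℂ)‖ ≤ 2 := by
  rw [Complex.norm_real, Real.norm_eq_abs, abs_of_nonneg (Real.sqrt_nonneg _)]
  exact Real.sqrt_le_iff.2 (by norm_num)

lemma s32 : ‖((Real.sqrt (3 / 2) : ℝ) : ℂ)‖ ≤ 2 := by
  rw [Complex.norm_real, Real.norm_eq_abs, abs_of_nonneg (Real.sqrt_nonneg _)]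
  exact Real.sqrt_le_iff.2 (by norm_num)

lemma Y0_le (x : ℝ) : ‖(Y0 x : ℂ)‖ ≤ 2 * sech x := by
  unfold Y0
  push_cast
  rw [norm_mul, norm_pow]
  have e : ‖(sech x : ℂ)‖ = sech x := by
    rw [Complex.norm_real, Real.norm_eq_abs, abs_of_pos (sech_pos x)]
  rw [e]
  have := sech_pos x
  have h1 : sech x ^ 2 ≤ sech x := by nlinarith [sech_le_one x]
  have := s34
  gcongr

lemma Y1_le (x : ℝ) : ‖(Y1 x : ℂ)‖ ≤ 2 * sech x := by
  unfold Y1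
  rw [Complex.ofReal_mul, Complex.ofReal_mul, norm_mul, norm_mul]
  have e : ‖(sech x : ℂ)‖ = sech x := by
    rw [Complex.norm_real, Real.norm_eq_abs, abs_of_pos (sech_pos x)]
  rw [e]
  have := sech_pos x
  have := s32
  have := tanh_norm x
  calc _ ≤ 2 * sech x * 1 := by gcongr
    _ = _ := by ring

lemma int_Y {Y : ℝ → ℂ} (hY : ∀ x, ‖Y x‖ ≤ 2 * sech x) {h : ℝ → ℂ} {B : ℝ}
    (hB : ∀ x, ‖h x‖ ≤ B) : ‖∫ y, Y y * h y‖ ≤ 8 * B := by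
  have hB0 : 0 ≤ B := (norm_nonneg _).trans (hB 0)
  have hi := (integrable_exp_abs (-1) (by norm_num)).const_mul (4 * B)
  have h1 := norm_integral_le_of_norm_le hi (f := fun y => Y y * h y)
    (Filter.Eventually.of_forall fun y => by
      rw [norm_mul]
      have h1 : ‖Y y‖ ≤ 4 * Real.exp (-1 * |y|) := (hY y).trans (by linarith [sech_le_exp y])
      calc _ ≤ (4 * Real.exp (-1 * |y|)) * B := by gcongr; exact hB y
        _ = _ := by ring)
  rw [integral_const_mul, integral_comp_abs (f := fun z => Real.exp (-1 * z)),
      integral_exp_mul_Ioi (by norm_num) 0] at h1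
  simp at h1
  linarith

lemma Y0_hasDeriv (x : ℝ) : HasDerivAt (fun x => (Y0 x : ℂ))
    (-2 * (Real.sqrt (3 / 4) : ℝ) * (sech x : ℂ) ^ 2 * Real.tanh x) x := by
  have h := ((sech_hasDeriv x).pow 2).const_mul ((Real.sqrt (3 / 4) : ℝ) : ℂ)
  have e : (fun x => (Y0 x : ℂ)) = fun x => ((Real.sqrt (3 / 4) : ℝ) : ℂ) *
      ((fun x => (sech x : ℂ)) ^ 2) x := by
    funext y; unfold Y0; push_cast; rfl
  rw [e]
  refine h.congr_deriv ?_
  push_cast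
  ring

lemma Y1_hasDeriv (x : ℝ) : HasDerivAt (fun x => (Y1 x : ℂ))
    ((Real.sqrt (3 / 2) : ℝ) * ((sech x : ℂ) - 2 * sech x * (Real.tanh x : ℂ) ^ 2)) x := by
  have h := (((sech_hasDeriv x).pow 2).mul (Real.hasDerivAt_sinh x).ofReal_comp).const_mul
    ((Real.sqrt (3 / 2) : ℝ) : ℂ)
  have e : (fun x => (Y1 x : ℂ)) = fun x => ((Real.sqrt (3 / 2) : ℝ) : ℂ) *
      (((fun x => (sech x : ℂ)) ^ 2) * fun y => (Real.sinh y : ℂ)) x := by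
    funext y
    unfold Y1
    simp only [Pi.mul_apply, Pi.pow_apply]
    rw [Complex.ofReal_mul, Complex.ofReal_mul, ← sech_sinh]; ring
  rw [e]
  refine h.congr_deriv ?_
  simp only [Pi.pow_apply]
  rw [← sech_sinh]
  linear_combination ((Real.sqrt (3 / 2) : ℝ) : ℂ) * sech x * sech_cosh x

lemma Pc_hasDeriv {h : ℝ → ℂ} {h' : ℂ} {x : ℝ} (hh : HasDerivAt h h' x) :
    HasDerivAt (Pc h) (h' - (∫ y : ℝ, (Y0 y : ℂ) * h y) *
        (-2 * (Real.sqrt (3 / 4) : ℝ) * (sech x : ℂ) ^ 2 * Real.tanh x)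
      - (∫ y : ℝ, (Y1 y : ℂ) * h y) *
        ((Real.sqrt (3 / 2) : ℝ) * ((sech x : ℂ) - 2 * sech x * (Real.tanh x : ℂ) ^ 2))) x :=
  (hh.sub ((Y0_hasDeriv x).const_mul _)).sub ((Y1_hasDeriv x).const_mul _)

lemma Y0'_le (x : ℝ) :
    ‖(-2 * (Real.sqrt (3 / 4) : ℝ) * (sech x : ℂ) ^ 2 * Real.tanh x : ℂ)‖ ≤ 6 := by
  have h1 := s34
  have h2 := sech_norm x
  have h3 := tanh_norm x
  rw [norm_mul, norm_mul, norm_mul, norm_pow, norm_neg]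
  have h0 : ‖(2 : ℂ)‖ = 2 := by norm_num
  rw [h0]
  calc _ ≤ (2 : ℝ) * 2 * 1 ^ 2 * 1 := by gcongr
    _ ≤ 6 := by norm_num

lemma Y1'_le (x : ℝ) :
    ‖((Real.sqrt (3 / 2) : ℝ) * ((sech x : ℂ) - 2 * sech x * (Real.tanh x : ℂ) ^ 2) : ℂ)‖ ≤ 6 := by
  have h1 := s32
  have h2 := sech_norm x
  have h3 := tanh_norm x
  have h0 : ‖(2 : ℂ)‖ = 2 := by norm_num
  have h4 : ‖(2 * sech x * (Real.tanh x : ℂ) ^ 2 : ℂ)‖ ≤ 2 := by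
    rw [norm_mul, norm_mul, norm_pow, h0]
    calc _ ≤ (2 : ℝ) * 1 * 1 ^ 2 := by gcongr
      _ = 2 := by norm_num
  rw [norm_mul]
  have h5 := norm_sub_le (sech x : ℂ) (2 * sech x * (Real.tanh x : ℂ) ^ 2)
  calc _ ≤ (2 : ℝ) * 3 := by gcongr; linarith
    _ = 6 := by norm_num

lemma comb_le {a b c d e : ℂ} {A B D : ℝ} (ha : ‖a‖ ≤ A) (hb : ‖b‖ ≤ B) (hd : ‖d‖ ≤ B)
    (hc : ‖c‖ ≤ D) (he : ‖e‖ ≤ D) : ‖a - b * c - d * e‖ ≤ A + 2 * (B * D) := by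
  have h1 := norm_sub_le (a - b * c) (d * e)
  have h2 := norm_sub_le a (b * c)
  have hB : 0 ≤ B := (norm_nonneg _).trans hb
  have h3 : ‖b * c‖ ≤ B * D := by rw [norm_mul]; gcongr
  have h4 : ‖d * e‖ ≤ B * D := by rw [norm_mul]; gcongr
  linarith

lemma part1 (v : ℝ → ℂ) (hv : Continuous v) (M : ℝ) (hM : ∀ x, ‖v x‖ ≤ M) (j : ℕ) (hj : j ≤ 1)
    (x : ℝ) :
    ‖iteratedDeriv j (I1op v) x‖ ≤ 100000 * M ∧
    ‖iteratedDeriv j (Jop v) x‖ ≤ 100000 * M ∧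
    ‖iteratedDeriv j (Pc (Jop v)) x‖ ≤ 100000 * M := by
  have hM0 : 0 ≤ M := (norm_nonneg _).trans (hM 0)
  have hI := sup_I1 hM x
  have hJ := sup_J hM x
  have i0 := int_Y Y0_le (sup_J hM)
  have i1 := int_Y Y1_le (sup_J hM)
  have ht := tanh_norm x
  interval_cases j
  · simp only [iteratedDeriv_zero]
    refine ⟨by linarith, by linarith, ?_⟩
    unfold Pc
    refine (comb_le hJ i0 i1 (D := 6) ?_ ?_).trans (by linarith)
    · linarith [Y0_le x, sech_le_one x]
    · linarith [Y1_le x, sech_le_one x]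
  · have hJ' : ‖I1op v x - 2 * Real.tanh x * Jop v x‖ ≤ 528 * M := by
      have h1 := norm_sub_le (I1op v x) (2 * Real.tanh x * Jop v x)
      have h2 : ‖(2 * Real.tanh x * Jop v x : ℂ)‖ ≤ 2 * 1 * (256 * M) := by
        rw [norm_mul, norm_mul, show ‖(2 : ℂ)‖ = 2 by norm_num]
        gcongr
      linarith
    simp only [iteratedDeriv_one]
    rw [(I1op_hasDeriv hv x).deriv, (Jop_hasDeriv hv x).deriv,
      (Pc_hasDeriv (Jop_hasDeriv hv x)).deriv]
    refine ⟨?_, by linarith, ?_⟩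
    · have h1 := norm_sub_le (v x) (Real.tanh x * I1op v x)
      have h2 : ‖(Real.tanh x * I1op v x : ℂ)‖ ≤ 1 * (16 * M) := by
        rw [norm_mul]
        gcongr
      linarith [hM x]
    · exact (comb_le hJ' i0 i1 (Y0'_le x) (Y1'_le x)).trans (by linarith)

lemma jb_cont : Continuous jb := by
  unfold jb; fun_prop

lemma eL2_enorm (F : ℝ → ℂ) : eLpNorm (fun x => ‖F x‖ₑ) 2 volume = eLpNorm F 2 volume := by
  exact eLpNorm_enorm F

lemma eL2_le {F : ℝ → ℂ} {G : ℝ → ℝ≥0∞} (h : ∀ x, ‖F x‖ₑ ≤ G x) :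
    eLpNorm F 2 volume ≤ eLpNorm G 2 volume :=
  eLpNorm_mono_enorm (fun x => by simpa using h x)

lemma bigC (n : ℝ≥0∞) (hn : n ≤ 100000) (a : ℝ≥0∞) : n * a ≤ ENNReal.ofReal 100000 * a := by
  gcongr
  simpa using hn

lemma deriv_L2 {f : ℝ → ℂ} (hf : Measurable (fun x => ‖f x‖ₑ)) {F : ℝ → ℂ}
    (h : ∀ x, ‖F x‖ₑ ≤ ‖f x‖ₑ + 2 * Aop (fun y => ‖f y‖ₑ) x) :
    eLpNorm F 2 volume ≤ ENNReal.ofReal 100000 * eLpNorm f 2 volume := by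
  have hA := Aop_measurable hf
  have h1 : eLpNorm F 2 volume ≤ eLpNorm ((fun x => ‖f x‖ₑ) +
      ((Aop (fun y => ‖f y‖ₑ)) + (Aop (fun y => ‖f y‖ₑ)))) 2 volume :=
    eL2_le (fun x => by simpa [two_mul] using h x)
  have h2 := eLpNorm_add_le (μ := volume) (p := 2) hf.aestronglyMeasurable
    (hA.add hA).aestronglyMeasurable (by norm_num)
  have h3 := eLpNorm_add_le (μ := volume) (p := 2) hA.aestronglyMeasurable
    hA.aestronglyMeasurable (by norm_num)
  have h4 := Aop_L2 hf
  rw [eL2_enorm] at h2 h4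
  refine (h1.trans (h2.trans ?_)).trans (bigC 33 (by norm_num) _)
  calc _ ≤ eLpNorm f 2 volume + (16 * eLpNorm f 2 volume + 16 * eLpNorm f 2 volume) := by
        gcongr
        exact h3.trans (by gcongr)
    _ = 33 * eLpNorm f 2 volume := by ring

lemma part2 (v : ℝ → ℂ) (hv : Measurable v) :
    eLpNorm (fun x => (jb x : ℂ) * I1op v x) 2 volume ≤
        ENNReal.ofReal 100000 * eLpNorm (fun x => (jb x : ℂ) * v x) 2 volume ∧
    eLpNorm (fun x => (jb x : ℂ) * Jop v x) 2 volume ≤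
        ENNReal.ofReal 100000 * eLpNorm (fun x => (jb x : ℂ) * v x) 2 volume := by
  have hm : Measurable (fun x => ‖(jb x : ℂ) * v x‖ₑ) :=
    ((Complex.continuous_ofReal.comp jb_cont).measurable.mul hv).enorm
  have h1 := Aop_L2 hm
  have h2 := Aop_L2 (Aop_measurable hm)
  rw [eL2_enorm] at h1
  constructor
  · exact ((eL2_le (fun x => I1op_bd goodW_jb v x)).trans h1).trans (bigC 16 (by norm_num) _)
  · refine ((eL2_le (fun x => Jop_bd goodW_jb v x)).trans h2).trans ?_
    refine le_trans (mul_le_mul_right h1 16) ?_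
    rw [← mul_assoc]
    exact bigC _ (by norm_num) _

lemma en_le {a b : ℂ} {A : ℝ≥0∞} (s t w : ℂ) (hs : ‖s‖ ≤ 1) (ht : ‖t‖ ≤ 2)
    (h : ‖w * b‖ₑ ≤ A) : ‖w * (-(s * a) - t * b)‖ₑ ≤ ‖w * a‖ₑ + 2 * A := by
  have hs' : ‖s‖ₑ ≤ 1 := by
    rw [← ofReal_norm]; exact ENNReal.ofReal_le_one.2 hs
  have ht' : ‖t‖ₑ ≤ 2 := by
    rw [← ofReal_norm]; simpa using ENNReal.ofReal_le_ofReal ht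
  have e : w * (-(s * a) - t * b) = -(s * (w * a)) - t * (w * b) := by ring
  rw [e]
  refine (enorm_sub_le).trans ?_
  rw [enorm_neg, enorm_mul, enorm_mul t]
  gcongr
  simpa using mul_le_mul_left hs' ‖w * a‖ₑ

lemma part3 (v : ℝ → ℂ) (hv : Continuous v) :
    (∀ j : ℕ, j ≤ 1 →
      eLpNorm (fun x => (jb x : ℂ)⁻¹ * iteratedDeriv j (I1til v) x) 2 volume ≤
          ENNReal.ofReal 100000 * eLpNorm (fun x => (jb x : ℂ)⁻¹ * v x) 2 volume ∧
      eLpNorm (fun x => (jb x : ℂ)⁻¹ * iteratedDeriv j (Jtil v) x) 2 volume ≤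
          ENNReal.ofReal 100000 * eLpNorm (fun x => (jb x : ℂ)⁻¹ * v x) 2 volume) ∧
    (∀ x : ℝ, (‖(jb x : ℂ)⁻¹ * I1til v x‖₊ : ℝ≥0∞) ≤
        ENNReal.ofReal 100000 * eLpNorm (fun x => (jb x : ℂ)⁻¹ * v x) 2 volume) ∧
    ∀ x : ℝ, (‖(jb x : ℂ)⁻¹ * Jtil v x‖₊ : ℝ≥0∞) ≤
        ENNReal.ofReal 100000 * eLpNorm (fun x => (jb x : ℂ)⁻¹ * v x) 2 volume := by
  have hm : Measurable (fun x => ‖(jb x : ℂ)⁻¹ * v x‖ₑ) :=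
    ((Complex.continuous_ofReal.comp jb_cont).measurable.inv.mul hv.measurable).enorm
  have h1 := Aop_L2 hm
  have h2 := Aop_Linf hm
  rw [eL2_enorm] at h1 h2
  have two_norm : ‖(2 : ℂ)‖ = 2 := by norm_num
  refine ⟨fun j hj => ?_, fun x => ?_, fun x => ?_⟩
  · interval_cases j
    · simp only [iteratedDeriv_zero]
      exact ⟨((eL2_le (fun x => I1til_bd goodW_jbinv v x)).trans h1).trans
          (bigC 16 (by norm_num) _),
        ((eL2_le (fun x => Jtil_bd goodW_jbinv v x)).trans h1).trans (bigC 16 (by norm_num) _)⟩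
    · simp only [iteratedDeriv_one]
      constructor
      · refine deriv_L2 hm (fun x => ?_)
        rw [(I1til_hasDeriv hv x).deriv]
        exact en_le _ _ _ (tanh_norm x) ((tanh_norm x).trans (by norm_num))
          (I1til_bd goodW_jbinv v x)
      · refine deriv_L2 hm (fun x => ?_)
        rw [(Jtil_hasDeriv hv x).deriv]
        have ht := tanh_norm x
        refine en_le _ _ _ ?_ ?_ (Jtil_bd goodW_jbinv v x)
        · rw [norm_mul, norm_pow, show ‖(1 / 2 : ℂ)‖ = 1 / 2 by norm_num]
          calc _ ≤ (1 / 2 : ℝ) * 1 ^ 2 := by gcongr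
            _ ≤ 1 := by norm_num
        · rw [norm_mul, two_norm]; linarith
  · exact ((I1til_bd goodW_jbinv v x).trans (h2 x)).trans (bigC 32 (by norm_num) _)
  · exact ((Jtil_bd goodW_jbinv v x).trans (h2 x)).trans (bigC 32 (by norm_num) _)

/-- Mapping bounds for the integral operators `I₁, J, P_c J, Ĩ₁, J̃`. -/
theorem integral_operator_bounds :
    ∃ C : ℝ, 1 ≤ C ∧
      (∀ v : ℝ → ℂ, Continuous v → ∀ M : ℝ, (∀ x, ‖v x‖ ≤ M) →
        ∀ j : ℕ, j ≤ 1 → ∀ x : ℝ,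
          ‖iteratedDeriv j (I1op v) x‖ ≤ C * M ∧
          ‖iteratedDeriv j (Jop v) x‖ ≤ C * M ∧
          ‖iteratedDeriv j (Pc (Jop v)) x‖ ≤ C * M) ∧
      (∀ v : ℝ → ℂ, Measurable v →
        eLpNorm (fun x => (jb x : ℂ) * I1op v x) 2 volume ≤
            ENNReal.ofReal C * eLpNorm (fun x => (jb x : ℂ) * v x) 2 volume ∧
        eLpNorm (fun x => (jb x : ℂ) * Jop v x) 2 volume ≤
            ENNReal.ofReal C * eLpNorm (fun x => (jb x : ℂ) * v x) 2 volume) ∧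
      ∀ v : ℝ → ℂ, ContDiff ℝ 1 v →
        (∀ j : ℕ, j ≤ 1 →
          eLpNorm (fun x => (jb x : ℂ)⁻¹ * iteratedDeriv j (I1til (deriv v)) x) 2 volume ≤
              ENNReal.ofReal C *
                eLpNorm (fun x => (jb x : ℂ)⁻¹ * deriv v x) 2 volume ∧
          eLpNorm (fun x => (jb x : ℂ)⁻¹ * iteratedDeriv j (Jtil (deriv v)) x) 2 volume ≤
              ENNReal.ofReal C *
                eLpNorm (fun x => (jb x : ℂ)⁻¹ * deriv v x) 2 volume) ∧
        (∀ x : ℝ, (‖(jb x : ℂ)⁻¹ * I1til (deriv v) x‖₊ : ℝ≥0∞) ≤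
            ENNReal.ofReal C * eLpNorm (fun x => (jb x : ℂ)⁻¹ * deriv v x) 2 volume) ∧
        ∀ x : ℝ, (‖(jb x : ℂ)⁻¹ * Jtil (deriv v) x‖₊ : ℝ≥0∞) ≤
            ENNReal.ofReal C * eLpNorm (fun x => (jb x : ℂ)⁻¹ * deriv v x) 2 volume := by
  exact ⟨100000, by norm_num, part1, part2,
    fun v hv => part3 (deriv v) (hv.continuous_deriv le_rfl)⟩
end
end

section
/- Let κ(y) := y·cosech(πy/2) for y ≠ 0 and κ(0) := 2/π (the continuous extension). Then for every ξ ∈ ℝ the following principal-value convolution identities hold, each limit existing: (i) lim_{δ→0⁺} ∫_{|η| ≥ δ} cosech(πη/2) · sech(π(ξ−η)/2) dη = 2ξ sech(πξ/2); (ii) lim_{δ→0⁺} ∫_{|η| ≥ δ} cosech(πη/2) · (ξ−η) sech(π(ξ−η)/2) dη = (ξ² − 1) sech(πξ/2); (iii) lim_{δ→0⁺} ∫_{|η| ≥ δ} cosech(πη/2) · κ(ξ−η) dη = ξ² cosech(πξ/2) for ξ ≠ 0, with the right-hand side of (iii) read as 0 when ξ = 0. -/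
open MeasureTheory Filter Topology

noncomputable section

/-- `cosech x = 1 / sinh x`. -/
def csch (x : ℝ) : ℝ := 1 / Real.sinh x

/-- `κ(y) = y cosech(πy/2)`, continuously extended by `2/π` at `y = 0`. -/
def Kker (y : ℝ) : ℝ := if y = 0 then 2 / Real.pi else y * csch (Real.pi * y / 2)

def sK (η : ℝ) : ℝ := 1 / (Real.sinh (Real.pi * η / 2) * Real.cosh (Real.pi * η / 2))

def uK (ξ η : ℝ) : ℝ :=
  Real.sinh (Real.pi * ξ / 2) / (Real.cosh (Real.pi * η / 2) * Real.cosh (Real.pi * (ξ - η) / 2))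

lemma sK_odd (x : ℝ) : sK (-x) = - sK x := by
  unfold sK
  have : Real.pi * -x / 2 = -(Real.pi * x / 2) := by ring
  rw [this, Real.sinh_neg, Real.cosh_neg, neg_mul, one_div_neg_eq_neg_one_div]

lemma meas_sK : Measurable sK := by unfold sK; fun_prop

lemma cont_uK (ξ : ℝ) : Continuous (uK ξ) := by
  unfold uK
  refine Continuous.div (by fun_prop) (by fun_prop) fun x => ?_
  have := Real.cosh_pos (Real.pi * x / 2)
  have := Real.cosh_pos (Real.pi * (ξ - x) / 2)
  positivity

lemma cosh_bound (x : ℝ) : (1 + |x|) / Real.cosh (Real.pi * x / 2) ≤ 12 * (1 + x ^ 2)⁻¹ := by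
  have hc := Real.cosh_pos (Real.pi * x / 2)
  rw [div_le_iff₀ hc, ← div_eq_mul_inv, div_mul_eq_mul_div, le_div_iff₀ (by positivity)]
  have h1 : Real.exp |x| / 2 ≤ Real.cosh (Real.pi * x / 2) := by
    rw [← Real.cosh_abs, Real.cosh_eq]
    have : |x| ≤ |Real.pi * x / 2| := by
      rw [abs_div, abs_mul, abs_of_pos Real.pi_pos, abs_of_pos (by norm_num : (0:ℝ) < 2)]
      nlinarith [Real.pi_gt_three, abs_nonneg x]
    have := Real.exp_le_exp.2 this
    have := Real.exp_pos (-|Real.pi * x / 2|)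
    linarith
  have h2 := Real.sum_le_exp_of_nonneg (abs_nonneg x) 4
  simp [Finset.sum_range_succ, Nat.factorial] at h2
  have h3 : x ^ 2 = |x| ^ 2 := (sq_abs x).symm
  rw [← sq_abs] at h2 ⊢
  have := abs_nonneg x
  nlinarith [pow_nonneg this 2, pow_nonneg this 3]

lemma int_base : Integrable (fun x : ℝ => (1 + |x|) / Real.cosh (Real.pi * x / 2)) := by
  refine (integrable_inv_one_add_sq.const_mul 12).mono' ?_ ?_
  · exact Measurable.aestronglyMeasurable (by fun_prop)
  · refine Eventually.of_forall fun x => ?_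
    rw [Real.norm_of_nonneg]
    · exact cosh_bound x
    · have hc := Real.cosh_pos (Real.pi * x / 2)
      positivity

lemma abs_uK (ξ η : ℝ) : |uK ξ η| ≤ |Real.sinh (Real.pi * ξ / 2)| / Real.cosh (Real.pi * η / 2) := by
  have h1 := Real.cosh_pos (Real.pi * η / 2)
  have h2 := Real.one_le_cosh (Real.pi * (ξ - η) / 2)
  unfold uK
  rw [abs_div, abs_of_pos (a := _ * _) (by positivity)]
  gcongr
  nlinarith

lemma int_uK (ξ : ℝ) : Integrable (uK ξ) := by
  refine (int_base.const_mul |Real.sinh (Real.pi * ξ / 2)|).mono'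
    (cont_uK ξ).aestronglyMeasurable (Eventually.of_forall fun x => ?_)
  have h1 := Real.cosh_pos (Real.pi * x / 2)
  refine (abs_uK ξ x).trans ?_
  rw [← mul_div_assoc]
  gcongr
  nlinarith [abs_nonneg x, abs_nonneg (Real.sinh (Real.pi * ξ / 2)),
    mul_nonneg (abs_nonneg (Real.sinh (Real.pi * ξ / 2))) (abs_nonneg x)]

lemma int_mul_uK (ξ : ℝ) : Integrable (fun η => η * uK ξ η) := by
  refine (int_base.const_mul |Real.sinh (Real.pi * ξ / 2)|).mono'
    (continuous_id.mul (cont_uK ξ)).aestronglyMeasurable (Eventually.of_forall fun x => ?_)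
  have h1 := Real.cosh_pos (Real.pi * x / 2)
  rw [Real.norm_eq_abs, abs_mul]
  refine (mul_le_mul_of_nonneg_left (abs_uK ξ x) (abs_nonneg x)).trans ?_
  rw [← mul_div_assoc, ← mul_div_assoc]
  refine div_le_div_of_nonneg_right ?_ h1.le
  nlinarith [abs_nonneg x, abs_nonneg (Real.sinh (Real.pi * ξ / 2)),
    mul_nonneg (abs_nonneg (Real.sinh (Real.pi * ξ / 2))) (abs_nonneg x)]

lemma int_mul_sK : Integrable (fun η => η * sK η) := by
  refine int_base.mono'
    (measurable_id.mul meas_sK).aestronglyMeasurable (Eventually.of_forall fun x => ?_)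
  have h1 := Real.cosh_pos (Real.pi * x / 2)
  by_cases hx : x = 0
  · subst hx
    simp
  have hs : |x| ≤ |Real.sinh (Real.pi * x / 2)| := by
    rw [Real.abs_sinh]
    refine le_trans ?_ (Real.self_le_sinh_iff.2 (abs_nonneg _))
    rw [abs_div, abs_mul, abs_of_pos Real.pi_pos, abs_of_pos (by norm_num : (0:ℝ) < 2)]
    nlinarith [Real.pi_gt_three, abs_nonneg x]
  have hx' : 0 < |x| := abs_pos.2 hx
  have hs' := hx'.trans_le hs
  unfold sK
  rw [Real.norm_eq_abs, abs_mul, abs_div, abs_mul, abs_of_pos h1, abs_one, mul_one_div,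
    ← div_div]
  gcongr
  calc |x| / |Real.sinh (Real.pi * x / 2)| ≤ 1 := (div_le_one hs').2 hs
    _ ≤ 1 + |x| := by linarith

lemma integral_uK (ξ : ℝ) : ∫ η, uK ξ η = 2 * ξ := by
  set c := Real.pi * ξ / 2 with hc
  have hd : ∀ x, HasDerivAt (fun η => (2 / Real.pi) *
      (Real.log (Real.cosh (Real.pi * η / 2) / Real.cosh (Real.pi * (ξ - η) / 2)))) (uK ξ x) x := by
    intro x
    have h1 := Real.cosh_pos (Real.pi * x / 2)
    have h2 := Real.cosh_pos (Real.pi * (ξ - x) / 2)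
    have e1 : HasDerivAt (fun η : ℝ => Real.pi * η / 2) (Real.pi * 1 / 2) x :=
      ((hasDerivAt_id x).const_mul _).div_const 2
    have e2 : HasDerivAt (fun η : ℝ => Real.pi * (ξ - η) / 2) (Real.pi * (-1) / 2) x :=
      (((hasDerivAt_id x).const_sub ξ).const_mul _).div_const 2
    have := ((e1.cosh.div e2.cosh h2.ne').log (div_pos h1 h2).ne').const_mul (2 / Real.pi)
    refine this.congr_deriv ?_
    unfold uK
    have : Real.pi * ξ / 2 = Real.pi * x / 2 + Real.pi * (ξ - x) / 2 := by ring
    rw [this, Real.sinh_add]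
    have := Real.pi_pos
    simp only [Pi.div_apply]
    field_simp
    ring
  have eqn : ∀ x : ℝ, Real.cosh (Real.pi * x / 2) / Real.cosh (Real.pi * (ξ - x) / 2) =
      (1 + Real.exp (-(Real.pi * x))) / (Real.exp c * Real.exp (-(Real.pi * x)) + Real.exp (-c)) := by
    intro x
    rw [Real.cosh_eq, Real.cosh_eq]
    rw [div_div_div_cancel_right₀ (by norm_num)]
    rw [div_eq_div_iff (by positivity) (by positivity)]
    simp only [add_mul, mul_add, ← Real.exp_add, one_mul]
    rw [hc]
    ring_nf
  have eqn' : ∀ x : ℝ, Real.cosh (Real.pi * x / 2) / Real.cosh (Real.pi * (ξ - x) / 2) =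
      (Real.exp (Real.pi * x) + 1) / (Real.exp c + Real.exp (-c) * Real.exp (Real.pi * x)) := by
    intro x
    rw [Real.cosh_eq, Real.cosh_eq]
    rw [div_div_div_cancel_right₀ (by norm_num)]
    rw [div_eq_div_iff (by positivity) (by positivity)]
    simp only [add_mul, mul_add, ← Real.exp_add, one_mul]
    rw [hc]
    ring_nf
  have t1 : Tendsto (fun x : ℝ => Real.exp (-(Real.pi * x))) atTop (𝓝 0) :=
    Real.tendsto_exp_neg_atTop_nhds_zero.comp (tendsto_id.const_mul_atTop Real.pi_pos)
  have t2 : Tendsto (fun x : ℝ => Real.exp (Real.pi * x)) atBot (𝓝 0) :=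
    Real.tendsto_exp_atBot.comp (tendsto_id.const_mul_atBot Real.pi_pos)
  have l1 := integral_of_hasDerivAt_of_tendsto hd (int_uK ξ) (m := (2 / Real.pi) * (-c))
    (n := (2 / Real.pi) * c) ?_ ?_
  · rw [l1, hc]
    have := Real.pi_pos
    field_simp
    ring
  · refine Tendsto.const_mul _ ?_
    simp only [eqn']
    have h : Tendsto (fun x : ℝ => (Real.exp (Real.pi * x) + 1) /
        (Real.exp c + Real.exp (-c) * Real.exp (Real.pi * x))) atBot
        (𝓝 ((0 + 1) / (Real.exp c + Real.exp (-c) * 0))) :=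
      (t2.add_const 1).div ((t2.const_mul _).const_add _) (by positivity)
    have e : (0 + 1) / (Real.exp c + Real.exp (-c) * 0) = Real.exp (-c) := by
      rw [Real.exp_neg]; simp
    rw [e] at h
    have := h.log (Real.exp_pos _).ne'
    rwa [Real.log_exp] at this
  · refine Tendsto.const_mul _ ?_
    simp only [eqn]
    have h : Tendsto (fun x : ℝ => (1 + Real.exp (-(Real.pi * x))) /
        (Real.exp c * Real.exp (-(Real.pi * x)) + Real.exp (-c))) atTop
        (𝓝 ((1 + 0) / (Real.exp c * 0 + Real.exp (-c)))) :=
      (t1.const_add 1).div ((t1.const_mul _).add_const _) (by positivity)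
    have e : (1 + 0) / (Real.exp c * 0 + Real.exp (-c)) = Real.exp c := by
      rw [Real.exp_neg]; simp
    rw [e] at h
    have := h.log (Real.exp_pos _).ne'
    rwa [Real.log_exp] at this

lemma uK_symm (ξ η : ℝ) : uK ξ (ξ - η) = uK ξ η := by
  unfold uK
  rw [sub_sub_cancel, mul_comm (Real.cosh _)]

lemma integral_mul_uK (ξ : ℝ) : ∫ η, η * uK ξ η = ξ ^ 2 := by
  have h := integral_sub_left_eq_self (fun η => η * uK ξ η) volume ξ
  simp only [uK_symm, sub_mul] at h
  rw [integral_sub ((int_uK ξ).const_mul ξ) (int_mul_uK ξ), integral_const_mul, integral_uK] at h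
  linarith

lemma odd_sum : HasSum (fun n : ℕ => 1 / ((2 * n + 1 : ℕ) : ℝ) ^ 2) (Real.pi ^ 2 / 8) := by
  have h := hasSum_zeta_two
  have hs := h.summable
  have i1 : Function.Injective (fun k : ℕ => 2 * k) := fun a b h => by simpa using h
  have i2 : Function.Injective (fun k : ℕ => 2 * k + 1) := fun a b h => by simpa using h
  have s2 : Summable (fun n : ℕ => 1 / ((2 * n + 1 : ℕ) : ℝ) ^ 2) := by
    simpa only [Function.comp_def] using hs.comp_injective i2
  have e : HasSum (fun n : ℕ => 1 / ((2 * n : ℕ) : ℝ) ^ 2) (1 / 4 * (Real.pi ^ 2 / 6)) := by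
    have h4 := h.mul_left (1 / 4 : ℝ)
    have ef : (fun n : ℕ => 1 / ((2 * n : ℕ) : ℝ) ^ 2) = fun n : ℕ => 1 / 4 * (1 / (n : ℝ) ^ 2) := ?_
    · rw [ef]; exact h4
    funext n
    push_cast
    rw [mul_pow]
    ring
  have := HasSum.even_add_odd (f := fun n : ℕ => 1 / (n : ℝ) ^ 2) e s2.hasSum
  have h3 := this.unique h
  convert s2.hasSum using 1
  linarith

lemma integral_term (a : ℝ) (ha : 0 < a) :
    IntegrableOn (fun x : ℝ => x * Real.exp (-(a * x))) (Set.Ioi 0) ∧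
    ∫ x in Set.Ioi (0:ℝ), x * Real.exp (-(a * x)) = 1 / a ^ 2 := by
  have h := Real.integral_rpow_mul_exp_neg_mul_Ioi (a := 2) (by norm_num) ha
  have e : ((2:ℝ) - 1) = 1 := by norm_num
  simp only [e, Real.rpow_one, Real.Gamma_two, mul_one] at h
  have h2 : ∫ x in Set.Ioi (0:ℝ), x * Real.exp (-(a * x)) = 1 / a ^ 2 := by
    rw [h]
    norm_num
  refine ⟨?_, h2⟩
  by_contra hn
  have := integral_undef hn
  rw [this] at h2
  have : 0 < 1 / a ^ 2 := by positivity
  linarith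

lemma integral_mul_sK : ∫ η, η * sK η = 1 := by
  have hpi := Real.pi_pos
  have heven : ∀ x : ℝ, x * sK x = |x| * sK |x| := by
    intro x
    rcases abs_choice x with h | h <;> rw [h]
    rw [sK_odd, neg_mul_neg]
  have h1 : ∫ η, η * sK η = 2 * ∫ x in Set.Ioi (0:ℝ), x * sK x := by
    rw [← integral_comp_abs (f := fun x => x * sK x)]
    exact integral_congr_ae (Eventually.of_forall heven)
  have hsum := hasSum_integral_of_summable_integral_norm (μ := volume.restrict (Set.Ioi (0:ℝ)))
    (F := fun (n : ℕ) (x : ℝ) => 4 * (x * Real.exp (-((2 * n + 1 : ℕ) * Real.pi * x)))) ?_ ?_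
  · have hv : ∀ n : ℕ, ∫ x in Set.Ioi (0:ℝ), 4 * (x * Real.exp (-((2 * n + 1 : ℕ) * Real.pi * x)))
        = 4 / Real.pi ^ 2 * (1 / ((2 * n + 1 : ℕ) : ℝ) ^ 2) := by
      intro n
      rw [integral_const_mul, (integral_term _ (by positivity)).2]
      field_simp
    simp only [hv] at hsum
    have := hsum.unique (odd_sum.mul_left (4 / Real.pi ^ 2))
    rw [h1]
    have h2 : ∫ x in Set.Ioi (0:ℝ), x * sK x = 4 / Real.pi ^ 2 * (Real.pi ^ 2 / 8) := by
      rw [← this]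
      refine setIntegral_congr_fun measurableSet_Ioi fun x hx => ?_
      have hx : 0 < x := hx
      have hr : Real.exp (-(2 * Real.pi * x)) < 1 := by
        rw [← Real.exp_zero, Real.exp_lt_exp]
        have := mul_pos hpi hx
        nlinarith
      have hg := (hasSum_geometric_of_lt_one (Real.exp_pos _).le hr).mul_left
        (4 * x * Real.exp (-(Real.pi * x)))
      have hg2 : HasSum (fun n : ℕ => 4 * (x * Real.exp (-((2 * n + 1 : ℕ) * Real.pi * x))))
          (4 * x * Real.exp (-(Real.pi * x)) * (1 - Real.exp (-(2 * Real.pi * x)))⁻¹) := by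
        have ef : (fun n : ℕ => 4 * (x * Real.exp (-((2 * n + 1 : ℕ) * Real.pi * x)))) =
            fun n : ℕ => 4 * x * Real.exp (-(Real.pi * x)) * Real.exp (-(2 * Real.pi * x)) ^ n := ?_
        · rw [ef]; exact hg
        funext n
        rw [← Real.exp_nat_mul, mul_assoc _ (Real.exp _), ← Real.exp_add]
        push_cast
        ring_nf
      beta_reduce
      rw [hg2.tsum_eq]
      unfold sK
      have hsc : Real.sinh (Real.pi * x / 2) * Real.cosh (Real.pi * x / 2)
          = Real.sinh (Real.pi * x) / 2 := by
        have := Real.sinh_two_mul (Real.pi * x / 2)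
        rw [show 2 * (Real.pi * x / 2) = Real.pi * x by ring] at this
        linarith
      rw [hsc, Real.sinh_eq]
      have e1 : Real.exp (-(2 * Real.pi * x)) = Real.exp (-(Real.pi * x)) ^ 2 := by
        rw [← Real.exp_nat_mul]; push_cast; ring_nf
      have e2 : Real.exp (Real.pi * x) = (Real.exp (-(Real.pi * x)))⁻¹ := by
        rw [← Real.exp_neg]; ring_nf
      rw [e1] at hr ⊢
      rw [e2]
      have hp := Real.exp_pos (-(Real.pi * x))
      generalize Real.exp (-(Real.pi * x)) = y at *
      have : 1 - y ^ 2 ≠ 0 := by linarith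
      have h4 : y⁻¹ - y = (1 - y ^ 2) / y := by field_simp
      rw [h4]
      field_simp
      norm_num
    rw [h2]
    field_simp
    norm_num
  · intro n
    exact (integral_term _ (by positivity)).1.const_mul 4
  · have hv : ∀ n : ℕ, ∫ x in Set.Ioi (0:ℝ), ‖4 * (x * Real.exp (-((2 * n + 1 : ℕ) * Real.pi * x)))‖
        = 4 / Real.pi ^ 2 * (1 / ((2 * n + 1 : ℕ) : ℝ) ^ 2) := by
      intro n
      rw [setIntegral_congr_fun (g := fun x : ℝ => 4 * (x * Real.exp (-((2 * n + 1 : ℕ) * Real.pi * x))))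
        measurableSet_Ioi, integral_const_mul, (integral_term _ (by positivity)).2]
      · field_simp
      · intro x hx
        have hx : 0 < x := hx
        exact Real.norm_of_nonneg (by positivity)
    simp only [hv]
    exact odd_sum.summable.mul_left _

lemma meas_set (δ : ℝ) : MeasurableSet {η : ℝ | δ ≤ |η|} :=
  measurableSet_le measurable_const (by fun_prop)

lemma odd_zero (f : ℝ → ℝ) (hf : ∀ x, f (-x) = - f x) (δ : ℝ) :
    ∫ η in {η : ℝ | δ ≤ |η|}, f η = 0 := by
  rw [← integral_indicator (meas_set δ)]
  have h := integral_neg_eq_self ({η : ℝ | δ ≤ |η|}.indicator f) volume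
  have e : ∀ x, ({η : ℝ | δ ≤ |η|}.indicator f) (-x) = - ({η : ℝ | δ ≤ |η|}.indicator f) x := by
    intro x
    by_cases hx : δ ≤ |x| <;> simp [Set.indicator, hx, hf]
  simp only [e, integral_neg] at h
  linarith

lemma intOn_sK (δ : ℝ) (hδ : 0 < δ) : IntegrableOn sK {η : ℝ | δ ≤ |η|} := by
  refine ((int_mul_sK.norm.const_mul δ⁻¹).integrableOn).mono' meas_sK.aestronglyMeasurable ?_
  refine (ae_restrict_iff' (meas_set δ)).2 (Eventually.of_forall fun x hx => ?_)
  have hx : δ ≤ |x| := hx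
  rw [norm_mul, ← mul_assoc]
  refine le_mul_of_one_le_left (norm_nonneg _) ?_
  rw [Real.norm_eq_abs, inv_mul_eq_div, one_le_div hδ]
  exact hx

lemma tendsto_pv (g : ℝ → ℝ) (hg : Integrable g) :
    Tendsto (fun δ : ℝ => ∫ η in {η : ℝ | δ ≤ |η|}, g η) (𝓝[>] (0 : ℝ)) (𝓝 (∫ η, g η)) := by
  simp only [← integral_indicator (meas_set _)]
  refine tendsto_integral_filter_of_dominated_convergence (fun x => ‖g x‖) ?_ ?_ hg.norm ?_
  · exact Eventually.of_forall fun δ => hg.aestronglyMeasurable.indicator (meas_set δ)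
  · exact Eventually.of_forall fun δ => Eventually.of_forall fun x => norm_indicator_le_norm_self _ _
  · have : ∀ᵐ x : ℝ, x ≠ 0 := Measure.ae_ne volume 0
    filter_upwards [this] with x hx
    refine tendsto_const_nhds.congr' ?_
    have : Set.Iio |x| ∈ 𝓝[>] (0:ℝ) := mem_nhdsWithin_of_mem_nhds (Iio_mem_nhds (abs_pos.2 hx))
    filter_upwards [this] with δ hδ
    exact (Set.indicator_of_mem (s := {η : ℝ | δ ≤ |η|}) (show δ ≤ |x| from le_of_lt hδ) g).symm

lemma pv_main (F g : ℝ → ℝ) (r k : ℝ) (hg : Integrable g)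
    (hF : ∀ᵐ η, F η = r * (k * sK η + g η)) :
    Tendsto (fun δ : ℝ => ∫ η in {η : ℝ | δ ≤ |η|}, F η) (𝓝[>] (0 : ℝ))
      (𝓝 (r * ∫ η, g η)) := by
  refine ((tendsto_pv g hg).const_mul r).congr' ?_
  filter_upwards [self_mem_nhdsWithin] with δ hδ
  rw [integral_congr_ae (ae_restrict_of_ae hF), integral_const_mul,
    integral_add ((intOn_sK δ hδ).const_mul k) hg.integrableOn, integral_const_mul,
    odd_zero sK sK_odd, mul_zero, zero_add]

lemma key1 (ξ η : ℝ) (hη : η ≠ 0) : csch (Real.pi * η / 2) * sech (Real.pi * (ξ - η) / 2)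
    = sech (Real.pi * ξ / 2) * (sK η + uK ξ η) := by
  unfold csch sech sK uK
  have h0 : Real.sinh (Real.pi * η / 2) ≠ 0 := by
    rw [Ne, Real.sinh_eq_zero]
    have := Real.pi_ne_zero
    positivity
  have e : Real.pi * (ξ - η) / 2 = Real.pi * ξ / 2 - Real.pi * η / 2 := by ring
  have h1 := (Real.cosh_pos (Real.pi * (ξ - η) / 2)).ne'
  rw [e] at h1 ⊢
  generalize Real.pi * ξ / 2 = c at *
  generalize Real.pi * η / 2 = a at *
  have h2 := (Real.cosh_pos a).ne'
  have h3 := (Real.cosh_pos c).ne'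
  have : Real.cosh c * Real.cosh a = Real.cosh (c - a) + Real.sinh c * Real.sinh a := by
    rw [Real.cosh_sub]; ring
  field_simp
  linarith

lemma key3 (ξ η : ℝ) (hξ : ξ ≠ 0) (hη : η ≠ 0) (hb : η ≠ ξ) :
    csch (Real.pi * η / 2) * csch (Real.pi * (ξ - η) / 2)
    = csch (Real.pi * ξ / 2) * (sK η + uK ξ η + sK (ξ - η)) := by
  have hp := Real.pi_ne_zero
  have hnz : ∀ x : ℝ, x ≠ 0 → Real.sinh (Real.pi * x / 2) ≠ 0 := by
    intro x hx
    rw [Ne, Real.sinh_eq_zero]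
    positivity
  unfold csch sK uK
  have h0 := hnz _ hη
  have h1 := hnz _ hξ
  have h2 := hnz _ (sub_ne_zero.2 hb.symm)
  have e : Real.pi * ξ / 2 = Real.pi * η / 2 + Real.pi * (ξ - η) / 2 := by ring
  have h3 := (Real.cosh_pos (Real.pi * η / 2)).ne'
  have h4 := (Real.cosh_pos (Real.pi * (ξ - η) / 2)).ne'
  rw [e] at h1 ⊢
  generalize Real.pi * (ξ - η) / 2 = b at *
  generalize Real.pi * η / 2 = a at *
  have e5 := Real.cosh_sq a
  have e6 := Real.cosh_sq b
  field_simp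
  rw [Real.sinh_add]
  linear_combination (Real.cosh b * Real.sinh b) * e5 + (Real.cosh a * Real.sinh a) * e6

lemma int_sub_mul_uK (ξ : ℝ) : Integrable (fun η => (ξ - η) * uK ξ η) := by
  simp only [sub_mul]
  exact ((int_uK ξ).const_mul ξ).sub (int_mul_uK ξ)

lemma integral_sub_mul_uK (ξ : ℝ) : ∫ η, (ξ - η) * uK ξ η = ξ ^ 2 := by
  simp only [sub_mul]
  rw [integral_sub ((int_uK ξ).const_mul ξ) (int_mul_uK ξ), integral_const_mul, integral_uK,
    integral_mul_uK]
  ring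

/-- Principal-value convolution identities `Ω∗ω₁`, `Ω∗ω₂`, `Ω∗ω₃` for
`Ω = p.v. cosech(π·/2)`. -/
theorem pv_convolution_identities :
    (∀ ξ : ℝ,
        Tendsto (fun δ : ℝ => ∫ η in {η : ℝ | δ ≤ |η|},
            csch (Real.pi * η / 2) * sech (Real.pi * (ξ - η) / 2))
          (𝓝[>] (0 : ℝ)) (𝓝 (2 * ξ * sech (Real.pi * ξ / 2)))) ∧
      (∀ ξ : ℝ,
        Tendsto (fun δ : ℝ => ∫ η in {η : ℝ | δ ≤ |η|},
            csch (Real.pi * η / 2) * ((ξ - η) * sech (Real.pi * (ξ - η) / 2)))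
          (𝓝[>] (0 : ℝ)) (𝓝 ((ξ ^ 2 - 1) * sech (Real.pi * ξ / 2)))) ∧
      ∀ ξ : ℝ,
        Tendsto (fun δ : ℝ => ∫ η in {η : ℝ | δ ≤ |η|},
            csch (Real.pi * η / 2) * Kker (ξ - η))
          (𝓝[>] (0 : ℝ)) (𝓝 (if ξ = 0 then 0 else ξ ^ 2 * csch (Real.pi * ξ / 2))) := by
  refine ⟨fun ξ => ?_, fun ξ => ?_, fun ξ => ?_⟩
  · have h := pv_main (fun η => csch (Real.pi * η / 2) * sech (Real.pi * (ξ - η) / 2)) (uK ξ)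
      (sech (Real.pi * ξ / 2)) 1 (int_uK ξ) ?_
    · rw [integral_uK, mul_comm] at h
      exact h
    · filter_upwards [Measure.ae_ne volume (0:ℝ)] with η hη
      rw [key1 ξ η hη, one_mul]
  · have h := pv_main
      (fun η => csch (Real.pi * η / 2) * ((ξ - η) * sech (Real.pi * (ξ - η) / 2)))
      (fun η => (ξ - η) * uK ξ η - η * sK η)
      (sech (Real.pi * ξ / 2)) ξ ((int_sub_mul_uK ξ).sub int_mul_sK) ?_
    · rw [integral_sub (int_sub_mul_uK ξ) int_mul_sK, integral_sub_mul_uK, integral_mul_sK,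
        mul_comm] at h
      exact h
    · filter_upwards [Measure.ae_ne volume (0:ℝ)] with η hη
      rw [mul_left_comm, key1 ξ η hη]
      ring
  · by_cases hξ : ξ = 0
    · subst hξ
      simp only [if_true]
      refine tendsto_const_nhds.congr fun δ => ?_
      rw [odd_zero]
      intro x
      have e1 : csch (Real.pi * -x / 2) = - csch (Real.pi * x / 2) := by
        unfold csch
        rw [show Real.pi * -x / 2 = -(Real.pi * x / 2) by ring, Real.sinh_neg,
          one_div_neg_eq_neg_one_div]
      have e2 : Kker (0 - -x) = Kker (0 - x) := by
        unfold Kker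
        by_cases hx : x = 0
        · simp [hx]
        · simp only [zero_sub, neg_neg, neg_eq_zero, hx, if_false, e1]
          ring
      rw [e1, e2, neg_mul]
    · rw [if_neg hξ]
      have i3 : Integrable (fun η => (ξ - η) * sK (ξ - η)) :=
        int_mul_sK.comp_sub_left ξ
      have v3 : ∫ η, (ξ - η) * sK (ξ - η) = 1 := by
        rw [integral_sub_left_eq_self (fun η => η * sK η) volume ξ, integral_mul_sK]
      have h := pv_main (fun η => csch (Real.pi * η / 2) * Kker (ξ - η))
        (fun η => (ξ - η) * uK ξ η - η * sK η + (ξ - η) * sK (ξ - η))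
        (csch (Real.pi * ξ / 2)) ξ (((int_sub_mul_uK ξ).sub int_mul_sK).add i3) ?_
      · have i12 : Integrable (fun η => (ξ - η) * uK ξ η - η * sK η) :=
          (int_sub_mul_uK ξ).sub int_mul_sK
        rw [integral_add i12 i3,
          integral_sub (int_sub_mul_uK ξ) int_mul_sK, integral_sub_mul_uK, integral_mul_sK, v3,
          mul_comm, sub_add_cancel] at h
        exact h
      · filter_upwards [Measure.ae_ne volume (0:ℝ), Measure.ae_ne volume ξ] with η hη hb
        rw [Kker, if_neg (sub_ne_zero.2 hb.symm), mul_left_comm, key3 ξ η hξ hη hb]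
        ring
end
end
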